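/- The discriminant function Δ(τ) = g₂(τ)³ − 27·g₃(τ)² is nowhere vanishing on the complex upper half plane. -/

import Mathlib

open scoped BigOperators

/-- The weight-`k` Eisenstein series of the lattice `ℤ + τℤ`:
`G_k(τ) = Σ'_{(m,n) ≠ (0,0)} 1/(m + nτ)^k`. -/
noncomputable def eisG (k : ℕ) (τ : ℂ) : ℂ :=
  ∑' p : ℤ × ℤ, if p = 0 then 0 else 1 / ((p.1 : ℂ) + (p.2 : ℂ) * τ) ^ k

/-- `g₂ = 60·G₄`. -/
noncomputable def gTwo (τ : ℂ) : ℂ := 60 * eisG 4 τ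

/-- `g₃ = 140·G₆`. -/
noncomputable def gThree (τ : ℂ) : ℂ := 140 * eisG 6 τ

open UpperHalfPlane EisensteinSeries ModularForm in
/-- The lattice sum `G_k` is the normalised Eisenstein series scaled by `2 ζ(k)`. -/
theorem eisG_eq_two_mul_riemannZeta_mul_E {k : ℕ} (hk : 3 ≤ k) (z : ℍ) :
    eisG k z = 2 * riemannZeta k * E hk z := by
  have hsum : eisG k z = ∑' v : Fin 2 → ℤ, eisSummand k v z := by
    rw [eisG, ← (finTwoArrowEquiv ℤ).symm.tsum_eq, ← (Equiv.prodComm ℤ ℤ).tsum_eq]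
    refine tsum_congr fun p ↦ ?_
    rcases eq_or_ne p 0 with rfl | hp
    · simp [eisSummand, show k ≠ 0 by omega]
    · have hswap : p.swap ≠ 0 := fun h ↦ hp (Prod.swap_injective h)
      simp [eisSummand, hswap, add_comm]
  have hE : E hk z = (1 / 2 : ℂ) * eisensteinSeries (N := 1) 0 k z := rfl
  rw [hsum, tsum_eisSummand_eq_riemannZeta_mul_eisensteinSeries hk, hE]
  ring

theorem riemannZeta_six : riemannZeta 6 = (Real.pi : ℂ) ^ 6 / 945 := by
  have h := riemannZeta_two_mul_nat (k := 3) (by norm_num)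
  have hb : bernoulli 6 = 1 / 42 := by
    rw [bernoulli_eq_bernoulli'_of_ne_one (by norm_num), bernoulli'_def]
    norm_num [Finset.sum_range_succ, Nat.choose, bernoulli'_eq_zero_of_odd]
  norm_num [hb, Nat.factorial] at h
  rw [h]
  ring

/-- The discriminant `Δ(τ) = g₂(τ)³ − 27·g₃(τ)²` is nowhere vanishing on
the upper half plane. -/
theorem stmt17 (τ : ℂ) (hτ : 0 < τ.im) :
    gTwo τ ^ 3 - 27 * gThree τ ^ 2 ≠ 0 := by
  lift τ to UpperHalfPlane using hτ
  have hΔ := ModularForm.discriminant_ne_zero τ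
  rw [ModularForm.discriminant_eq_E₄_cube_sub_E₆_sq] at hΔ
  have h4 := eisG_eq_two_mul_riemannZeta_mul_E (k := 4) (by norm_num) τ
  have h6 := eisG_eq_two_mul_riemannZeta_mul_E (k := 6) (by norm_num) τ
  norm_num only [Nat.cast_ofNat, riemannZeta_four, riemannZeta_six] at h4 h6
  rw [gTwo, gThree, h4, h6]
  refine ne_of_eq_of_ne ?_ (mul_ne_zero
    (mul_ne_zero (by norm_num : (4096 : ℂ) ≠ 0)
      (pow_ne_zero 12 (Complex.ofReal_ne_zero.mpr Real.pi_ne_zero))) hΔ)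
  ring
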